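/- Let P = ∏_{h=-m}^{m-1}(α+1+2h), 2* = 2(α+1)/(α-2m+1), z(r) = P^{(α-2m+1)/(4m)} (1+r²)^{-(α-2m+1)/2}. Given that z satisfies (-Δ_α)^m z = z^{2*-1} and ∫₀^∞ |∇_α^m z|² r^α dr = ∫₀^∞ z^{2*} r^α dr, the ratio S = (∫₀^∞ |∇_α^m z|² r^α dr) / (∫₀^∞ z^{2*} r^α dr)^{2/2*} equals P · [Γ((α+1)/2)² / (2Γ(α+1))]^{2m/(α+1)}; equivalently S^{-1/2} = P^{-1/2} [2Γ(α+1)/Γ((α+1)/2)²]^{m/(α+1)}. -/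

import Mathlib

open MeasureTheory

/-- The α-generalized radial Laplacian: Δ_α v(r) = v''(r) + (α/r) v'(r). -/
noncomputable def lapl (α : ℝ) (v : ℝ → ℝ) : ℝ → ℝ :=
  fun r => deriv (deriv v) r + (α / r) * deriv v r

/-- The m-fold iterate of -Δ_α. -/
noncomputable def negLaplIter (α : ℝ) (m : ℕ) : (ℝ → ℝ) → (ℝ → ℝ) :=
  (fun v r => -(lapl α v r))^[m]

/-- ∇_α^m z = Δ_α^k z if m = 2k, and (Δ_α^k z)' if m = 2k+1. -/
noncomputable def gradm (α : ℝ) (m : ℕ) (z : ℝ → ℝ) : ℝ → ℝ :=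
  if m % 2 = 0 then (lapl α)^[m / 2] z else deriv ((lapl α)^[m / 2] z)

lemma beta_half_line (a : ℝ) (ha : 0 < a) :
    ∫ r in Set.Ioi (0 : ℝ), (1 + r ^ 2) ^ (-(2 * a)) * r ^ (2 * a - 1) =
      Real.Gamma a ^ 2 / (2 * Real.Gamma (2 * a)) := by
  have h1 : ∫ x in Set.Ioo (0 : ℝ) 1, x ^ (a - 1) * (1 - x) ^ (a - 1) =
      Real.Gamma a ^ 2 / Real.Gamma (2 * a) := by
    have hb := Complex.betaIntegral_eq_Gamma_mul_div (a : ℂ) (a : ℂ) (by simpa) (by simpa)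
    have hr : Complex.betaIntegral a a =
        ((∫ x in Set.Ioo (0 : ℝ) 1, x ^ (a - 1) * (1 - x) ^ (a - 1) : ℝ) : ℂ) := by
      rw [Complex.betaIntegral, intervalIntegral.integral_of_le zero_le_one,
        integral_Ioc_eq_integral_Ioo, ← integral_complex_ofReal]
      refine setIntegral_congr_fun measurableSet_Ioo fun x hx => ?_
      have h1 : (0 : ℝ) ≤ x := hx.1.le
      have h2 : (0 : ℝ) ≤ 1 - x := by linarith [hx.2]
      push_cast [Complex.ofReal_cpow h1, Complex.ofReal_cpow h2]
      rfl
    rw [hr, ← Complex.ofReal_add, Complex.Gamma_ofReal, Complex.Gamma_ofReal] at hb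
    have : (∫ x in Set.Ioo (0 : ℝ) 1, x ^ (a - 1) * (1 - x) ^ (a - 1)) =
        Real.Gamma a * Real.Gamma a / Real.Gamma (a + a) := by exact_mod_cast hb
    rw [this, two_mul, sq]
  have hinj : Set.InjOn (fun r : ℝ => r ^ 2 / (1 + r ^ 2)) (Set.Ioi 0) := by
    intro x hx y hy h
    have hx' : (0 : ℝ) < x := hx
    have hy' : (0 : ℝ) < y := hy
    simp only at h
    rw [div_eq_div_iff (by positivity) (by positivity)] at h
    nlinarith
  have himg : (fun r : ℝ => r ^ 2 / (1 + r ^ 2)) '' (Set.Ioi 0) = Set.Ioo 0 1 := by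
    ext t
    constructor
    · rintro ⟨r, hr, rfl⟩
      have hr' : (0 : ℝ) < r := hr
      refine ⟨by positivity, ?_⟩
      simp only
      rw [div_lt_one (by positivity)]
      linarith
    · rintro ⟨h0, h1⟩
      have h1' : 0 < 1 - t := by linarith
      refine ⟨Real.sqrt (t / (1 - t)), Real.sqrt_pos.2 (by positivity), ?_⟩
      simp only
      rw [Real.sq_sqrt (by positivity)]
      field_simp
      ring
  have hder : ∀ r ∈ Set.Ioi (0 : ℝ), HasDerivWithinAt (fun r : ℝ => r ^ 2 / (1 + r ^ 2))
      (2 * r / (1 + r ^ 2) ^ 2) (Set.Ioi 0) r := by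
    intro r _
    have hne : (1 + r ^ 2) ≠ 0 := by positivity
    have := ((hasDerivAt_pow 2 r).div ((hasDerivAt_pow 2 r).const_add 1) hne).hasDerivWithinAt
      (s := Set.Ioi 0)
    refine this.congr_deriv ?_
    field_simp
    push_cast
    ring
  have h2 := integral_image_eq_integral_abs_deriv_smul measurableSet_Ioi hder hinj
    (fun x : ℝ => x ^ (a - 1) * (1 - x) ^ (a - 1))
  rw [himg, h1] at h2
  have h3 : ∫ r in Set.Ioi (0 : ℝ), |2 * r / (1 + r ^ 2) ^ 2| •
      ((r ^ 2 / (1 + r ^ 2)) ^ (a - 1) * (1 - r ^ 2 / (1 + r ^ 2)) ^ (a - 1)) =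
      ∫ r in Set.Ioi (0 : ℝ), 2 * ((1 + r ^ 2) ^ (-(2 * a)) * r ^ (2 * a - 1)) := by
    refine setIntegral_congr_fun measurableSet_Ioi fun r hr => ?_
    have hr' : (0 : ℝ) < r := hr
    have hp : 0 < 1 + r ^ 2 := by positivity
    simp only [smul_eq_mul]
    rw [abs_of_pos (by positivity)]
    have e1 : 1 - r ^ 2 / (1 + r ^ 2) = 1 / (1 + r ^ 2) := by field_simp; ring
    rw [e1, Real.div_rpow (by positivity) hp.le, Real.div_rpow zero_le_one hp.le, Real.one_rpow]
    have e2 : (r ^ 2) ^ (a - 1) * r = r ^ (2 * a - 1) := by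
      rw [← Real.rpow_natCast r 2, ← Real.rpow_mul hr'.le]
      nth_rewrite 2 [← Real.rpow_one r]
      rw [← Real.rpow_add hr']
      congr 1
      push_cast
      ring
    have e3 : (1 + r ^ 2) ^ (-(2 * a)) =
        1 / ((1 + r ^ 2) ^ (a - 1) * (1 + r ^ 2) ^ (a - 1) * (1 + r ^ 2) ^ 2) := by
      rw [Real.rpow_neg hp.le, one_div, ← Real.rpow_natCast (1 + r ^ 2) 2,
        ← Real.rpow_add hp, ← Real.rpow_add hp]
      congr 2
      push_cast
      ring
    rw [e3, ← e2]
    have : (1 + r ^ 2) ^ (a - 1) ≠ 0 := (Real.rpow_pos_of_pos hp _).ne'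
    field_simp
  rw [h3, integral_const_mul] at h2
  have : ∀ x y : ℝ, x / (2 * y) = (x / y) / 2 := fun x y => by
    rw [div_div, mul_comm]
  rw [this, h2]
  ring

theorem stmt_19 (m : ℕ) (hm : 1 ≤ m) (α : ℝ) (hα : -1 < α) (hSob : α - 2 * m + 1 > 0)
    (P : ℝ) (hP : P = ∏ h ∈ Finset.range (2 * m), (α + 1 + 2 * ((h : ℝ) - m)))
    (ts : ℝ) (hts : ts = 2 * (α + 1) / (α - 2 * m + 1))
    (z : ℝ → ℝ)
    (hz : z = fun r : ℝ =>
      P ^ ((α - 2 * m + 1) / (4 * m)) * (1 + r ^ 2) ^ (-((α - 2 * m + 1) / 2)))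
    (heq : ∀ r : ℝ, 0 < r → negLaplIter α m z r = z r ^ (ts - 1))
    (henergy : ∫ r in Set.Ioi (0 : ℝ), (gradm α m z r) ^ 2 * r ^ α =
      ∫ r in Set.Ioi (0 : ℝ), z r ^ ts * r ^ α) :
    (∫ r in Set.Ioi (0 : ℝ), (gradm α m z r) ^ 2 * r ^ α) /
        (∫ r in Set.Ioi (0 : ℝ), z r ^ ts * r ^ α) ^ (2 / ts) =
      P * (Real.Gamma ((α + 1) / 2) ^ 2 / (2 * Real.Gamma (α + 1))) ^
        (2 * m / (α + 1)) := by
  rw [henergy]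
  have hn : 0 < α + 1 := by linarith
  have hm' : (0 : ℝ) < m := by exact_mod_cast hm
  have hPpos : 0 < P := by
    rw [hP]
    refine Finset.prod_pos fun h _ => ?_
    have : (0 : ℝ) ≤ h := Nat.cast_nonneg h
    linarith
  have hJ := beta_half_line ((α + 1) / 2) (by linarith)
  have hn2 : 2 * ((α + 1) / 2) = α + 1 := by ring
  rw [hn2, add_sub_cancel_right] at hJ
  have hI : ∫ r in Set.Ioi (0 : ℝ), z r ^ ts * r ^ α =
      P ^ ((α + 1) / (2 * m)) *
        (Real.Gamma ((α + 1) / 2) ^ 2 / (2 * Real.Gamma (α + 1))) := by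
    rw [← hJ, ← integral_const_mul]
    refine setIntegral_congr_fun measurableSet_Ioi fun r hr => ?_
    have hp : 0 < 1 + r ^ 2 := by positivity
    simp only [hz]
    rw [Real.mul_rpow (by positivity) (by positivity), ← Real.rpow_mul hPpos.le,
      ← Real.rpow_mul hp.le, mul_assoc]
    have hne := hSob.ne'
    congr 2
    · rw [hts]
      field_simp
      ring
    · congr 1
      rw [hts]
      field_simp
  rw [hI]
  have hG1 : 0 < Real.Gamma ((α + 1) / 2) := Real.Gamma_pos_of_pos (by linarith)
  have hG2 : 0 < Real.Gamma (α + 1) := Real.Gamma_pos_of_pos hn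
  set J := Real.Gamma ((α + 1) / 2) ^ 2 / (2 * Real.Gamma (α + 1)) with hJd
  have hJpos : 0 < J := by positivity
  have hIpos : 0 < P ^ ((α + 1) / (2 * m)) * J := by positivity
  nth_rewrite 1 [← Real.rpow_one (P ^ ((α + 1) / (2 * m)) * J)]
  rw [← Real.rpow_sub hIpos]
  have he : 1 - 2 / ts = 2 * m / (α + 1) := by
    rw [hts]
    have hne := hSob.ne'
    field_simp
    ring
  rw [he, Real.mul_rpow (by positivity) hJpos.le, ← Real.rpow_mul hPpos.le]
  have : (α + 1) / (2 * m) * (2 * m / (α + 1)) = 1 := by field_simp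
  rw [this, Real.rpow_one]
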